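/- There exist a number n of agents and items and a preference profile on that instance such that no random assignment simultaneously satisfies ex-post favoring-eagerness-for-remaining-items (ex-post FERI), ex-ante favoring-eagerness-for-remaining-items (ea-FERI), and strong equal treatment of equals (SETE); consequently, no mechanism satisfies all three properties. -/

import Mathlib

open Finset

noncomputable section

namespace FeriPaper

/-- A preference profile: `R j o o'` means agent `j` strictly prefers item `o` to `o'`. -/
abbrev Pref (n : ℕ) := Fin n → Fin n → Fin n → Prop

/-- Every agent's preference is a strict linear (total) order on the items. -/
def IsProfile {n : ℕ} (R : Pref n) : Prop :=
  ∀ j : Fin n, IsStrictTotalOrder (Fin n) (R j)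

/-- Profiles as a type (for mechanisms). -/
def Profile (n : ℕ) := { R : Pref n // IsProfile R }

/-- `o` is agent `j`'s most preferred item in the set `S`. -/
def IsTopIn {n : ℕ} (R : Pref n) (j : Fin n) (S : Set (Fin n)) (o : Fin n) : Prop :=
  o ∈ S ∧ ∀ o' ∈ S, o' ≠ o → R j o o'

/-- `Tunion R A r` is the union `T_1(A) ∪ ⋯ ∪ T_r(A)` (so `Tunion R A 0 = ∅`). -/
def Tunion {n : ℕ} (R : Pref n) (A : Equiv.Perm (Fin n)) : ℕ → Set (Fin n)
  | 0 => ∅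
  | r + 1 =>
      Tunion R A r ∪
        {o | ∃ j : Fin n, A j ∉ Tunion R A r ∧ IsTopIn R j (Tunion R A r)ᶜ o}

/-- `Tset R A r` is the set `T_{r+1}(A)` (0-based round index). -/
def Tset {n : ℕ} (R : Pref n) (A : Equiv.Perm (Fin n)) (r : ℕ) : Set (Fin n) :=
  {o | ∃ j : Fin n, A j ∉ Tunion R A r ∧ IsTopIn R j (Tunion R A r)ᶜ o}

/-- Favoring-eagerness-for-remaining-items (FERI). -/
def FERI {n : ℕ} (R : Pref n) (A : Equiv.Perm (Fin n)) : Prop :=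
  ∀ r : ℕ, ∀ o ∈ Tset R A r, IsTopIn R (A.symm o) (Tunion R A r)ᶜ o

/-- Pareto efficiency (PE) of a deterministic assignment. -/
def ParetoEff {n : ℕ} (R : Pref n) (A : Equiv.Perm (Fin n)) : Prop :=
  ¬ ∃ (A' : Equiv.Perm (Fin n)) (N' : Set (Fin n)), N'.Nonempty ∧
      (∀ j ∈ N', R j (A' j) (A j)) ∧ ∀ k, k ∉ N' → A' k = A k

/-- Number of agents receiving their overall first choice. -/
def firstChoiceCount {n : ℕ} (R : Pref n) (A : Equiv.Perm (Fin n)) : ℕ :=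
  {j : Fin n | IsTopIn R j Set.univ (A j)}.ncard

/-- First-choice maximality (FCM). -/
def FCM {n : ℕ} (R : Pref n) (A : Equiv.Perm (Fin n)) : Prop :=
  ¬ ∃ A' : Equiv.Perm (Fin n), firstChoiceCount R A < firstChoiceCount R A'

/-- Rank of item `o` in agent `j`'s preference (1 = most preferred). -/
def rank {n : ℕ} (R : Pref n) (j o : Fin n) : ℕ :=
  {o' : Fin n | R j o' o ∨ o' = o}.ncard

/-- Favoring-higher-ranks (FHR). -/
def FHR {n : ℕ} (R : Pref n) (A : Equiv.Perm (Fin n)) : Prop :=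
  ∀ j k : Fin n, rank R j (A j) ≤ rank R k (A j) ∨ rank R k (A k) < rank R k (A j)

/-- Popularity (POP). -/
def POP {n : ℕ} (R : Pref n) (A : Equiv.Perm (Fin n)) : Prop :=
  ¬ ∃ A' : Equiv.Perm (Fin n),
      {j : Fin n | R j (A j) (A' j)}.ncard < {j : Fin n | R j (A' j) (A j)}.ncard

/-- Signature of a deterministic assignment: `signature R A r` is the number of agents
    assigned their `r`-th ranked item. -/
def signature {n : ℕ} (R : Pref n) (A : Equiv.Perm (Fin n)) (r : ℕ) : ℕ :=
  {j : Fin n | rank R j (A j) = r}.ncard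

/-- `x` dominates `y` as signatures. -/
def SigDom (x y : ℕ → ℕ) : Prop :=
  ∃ r : ℕ, y r < x r ∧ ∀ r' < r, y r' ≤ x r'

/-- Rank maximality (RM). -/
def RM {n : ℕ} (R : Pref n) (A : Equiv.Perm (Fin n)) : Prop :=
  ¬ ∃ A' : Equiv.Perm (Fin n), SigDom (signature R A') (signature R A)

/-- A random assignment: a doubly stochastic matrix. -/
def DoublyStochastic {n : ℕ} (P : Fin n → Fin n → ℝ) : Prop :=
  (∀ j o, 0 ≤ P j o) ∧ (∀ j, ∑ o, P j o = 1) ∧ (∀ o, ∑ j, P j o = 1)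

/-- The 0-1 permutation matrix of a deterministic assignment. -/
def permMatrix {n : ℕ} (A : Equiv.Perm (Fin n)) : Fin n → Fin n → ℝ :=
  fun j o => if A j = o then 1 else 0

/-- Upper contour set of item `o` under the strict preference `pr`. -/
def ucs {n : ℕ} (pr : Fin n → Fin n → Prop) (o : Fin n) : Set (Fin n) :=
  {x | pr x o ∨ x = o}

/-- Total probability mass on the upper contour set of `o`. -/
def upperSum {n : ℕ} (pr : Fin n → Fin n → Prop) (p : Fin n → ℝ) (o : Fin n) : ℝ :=
  ∑ x, (ucs pr o).indicator p x

/-- `p` (weakly) stochastically dominates `q` w.r.t. the strict preference `pr`. -/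
def SD {n : ℕ} (pr : Fin n → Fin n → Prop) (p q : Fin n → ℝ) : Prop :=
  ∀ o, upperSum pr q o ≤ upperSum pr p o

/-- sd-envy-freeness. -/
def sdEF {n : ℕ} (R : Pref n) (P : Fin n → Fin n → ℝ) : Prop :=
  ∀ j k : Fin n, SD (R j) (P j) (P k)

/-- sd-weak-envy-freeness. -/
def sdWEF {n : ℕ} (R : Pref n) (P : Fin n → Fin n → ℝ) : Prop :=
  ∀ j k : Fin n, SD (R j) (P k) (P j) → P j = P k

/-- The common prefix of the preferences of agents `j` and `k`: items all of whose
    (weak) upper contour sets w.r.t. `j` coincide for `j` and `k`. -/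
def commonPrefix {n : ℕ} (R : Pref n) (j k : Fin n) : Set (Fin n) :=
  {o | ∀ x ∈ ucs (R j) o, ucs (R j) x = ucs (R k) x}

/-- Strong equal treatment of equals (SETE). -/
def SETE {n : ℕ} (R : Pref n) (P : Fin n → Fin n → ℝ) : Prop :=
  ∀ j k : Fin n, ∀ o ∈ commonPrefix R j k, P j o = P k o

/-- A random assignment satisfies a property `X` ex post if it is a convex combination
    of (permutation matrices of) deterministic assignments each satisfying `X`. -/
def ExPost {n : ℕ} (X : Equiv.Perm (Fin n) → Prop) (P : Fin n → Fin n → ℝ) : Prop :=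
  ∃ w : Equiv.Perm (Fin n) → ℝ, (∀ A, 0 ≤ w A) ∧ (∑ A, w A) = 1 ∧
    (∀ A, w A ≠ 0 → X A) ∧ ∀ j o, P j o = ∑ A, w A * permMatrix A j o

/-- Ex-ante favoring-higher-ranks (ea-FHR). -/
def EaFHR {n : ℕ} (R : Pref n) (P : Fin n → Fin n → ℝ) : Prop :=
  ∀ j o, 0 < P j o → ∀ k, rank R k o < rank R j o → upperSum (R k) (P k) o = 1

/-- The eating structure for ea-FERI: `(eaState R P r).1 = M_{P,r+1}` and
    `(eaState R P r).2 o = ⋃_{r' ≤ r+1} E_{P,r'}(o)` (1-based indexing on the right). -/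
def eaState {n : ℕ} (R : Pref n) (P : Fin n → Fin n → ℝ) :
    ℕ → Set (Fin n) × (Fin n → Set (Fin n))
  | 0 => (Set.univ, fun o => {j | IsTopIn R j Set.univ o})
  | r + 1 =>
      let prev := eaState R P r
      let M : Set (Fin n) := {o | ∑ k, (prev.2 o).indicator (fun k' => P k' o) k < 1}
      (M, fun o => prev.2 o ∪ {j | IsTopIn R j M o})

/-- `eaM R P r = M_{P,r+1}` (0-based round index). -/
def eaM {n : ℕ} (R : Pref n) (P : Fin n → Fin n → ℝ) (r : ℕ) : Set (Fin n) :=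
  (eaState R P r).1

/-- `eaE R P r o = E_{P,r+1}(o)` (0-based round index). -/
def eaE {n : ℕ} (R : Pref n) (P : Fin n → Fin n → ℝ) (r : ℕ) (o : Fin n) : Set (Fin n) :=
  {j | IsTopIn R j (eaM R P r) o}

/-- Ex-ante FERI (ea-FERI). -/
def EaFERI {n : ℕ} (R : Pref n) (P : Fin n → Fin n → ℝ) : Prop :=
  ∀ r : ℕ, ∀ o ∈ eaM R P r, ∀ j : Fin n, (∃ r' < r, j ∈ eaE R P r' o) →
    upperSum (R j) (P j) o = 1

/-- sd-Pareto-efficiency (sd-PE). -/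
def SdPE {n : ℕ} (R : Pref n) (P : Fin n → Fin n → ℝ) : Prop :=
  ¬ ∃ Q : Fin n → Fin n → ℝ, DoublyStochastic Q ∧ Q ≠ P ∧ ∀ j, SD (R j) (Q j) (P j)

/-- `A` is the output of the adaptive Boston mechanism with priority order `prio`
    (`prio j k` means `j` has higher priority than `k`): in every round, every item that
    receives applicants is assigned to its highest-priority applicant. -/
def ABMOutcome {n : ℕ} (prio : Fin n → Fin n → Prop) (R : Pref n)
    (A : Equiv.Perm (Fin n)) : Prop :=
  ∀ r : ℕ, ∀ o ∈ Tset R A r,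
    IsTopIn R (A.symm o) (Tunion R A r)ᶜ o ∧
      ∀ j : Fin n, A j ∉ Tunion R A r → IsTopIn R j (Tunion R A r)ᶜ o →
        j ≠ A.symm o → prio (A.symm o) j

end FeriPaper

namespace FeriPaper

/-- Ranks (0 = best) of items in the counterexample profile. The orders are
agent 0: 0 1 6 5 3 2 4; agents 1, 6: 0 6 1 3 2 5 4; agents 2, 5: 0 6 3 5 2 4 1;
agent 3: 0 3 4 6 1 5 2; agent 4: 0 5 1 3 6 4 2. -/
def rk : Fin 7 → Fin 7 → ℕ :=
  ![![0, 1, 5, 4, 6, 3, 2],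
    ![0, 2, 4, 3, 6, 5, 1],
    ![0, 6, 4, 2, 5, 3, 1],
    ![0, 4, 6, 1, 2, 5, 3],
    ![0, 2, 6, 3, 5, 1, 4],
    ![0, 6, 4, 2, 5, 3, 1],
    ![0, 2, 4, 3, 6, 5, 1]]

/-- The counterexample profile. -/
def RR : Pref 7 := fun j o o' => rk j o < rk j o'

theorem rk_inj : ∀ j a b : Fin 7, rk j a = rk j b → a = b := by decide

theorem RR_profile : IsProfile RR := by
  intro j
  refine { trichotomous := ?_, irrefl := ?_, trans := ?_ }
  · intro a b h1 h2
    exact rk_inj j a b (le_antisymm (not_lt.1 h2) (not_lt.1 h1))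
  · intro a h
    exact lt_irrefl _ h
  · intro a b c h1 h2
    exact lt_trans h1 h2

/-- Top items, with the available set a Finset. -/
def topB (j : Fin 7) (S : Finset (Fin 7)) (o : Fin 7) : Prop :=
  o ∈ S ∧ ∀ o' ∈ S, o' ≠ o → rk j o < rk j o'

instance (j : Fin 7) (S : Finset (Fin 7)) (o : Fin 7) : Decidable (topB j S o) := by
  unfold topB; infer_instance

theorem top_iff (j : Fin 7) (S : Finset (Fin 7)) (o : Fin 7) :
    IsTopIn RR j (S : Set (Fin 7)) o ↔ topB j S o := by
  simp only [IsTopIn, topB, RR, Finset.mem_coe]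

/-- Cumulative claimant sets. -/
def cum (L : List (Finset (Fin 7))) (o j : Fin 7) : Prop := ∃ S ∈ L, topB j S o

instance (L : List (Finset (Fin 7))) (o j : Fin 7) : Decidable (cum L o j) := by
  unfold cum; infer_instance

theorem mem_prefix (j k o : Fin 7)
    (h : ∀ x, (rk j x < rk j o ∨ x = o) →
      ∀ y, (rk j y < rk j x ∨ y = x) ↔ (rk k y < rk k x ∨ y = x)) :
    o ∈ commonPrefix RR j k := by
  intro x hx
  ext y
  exact h x hx y

theorem feri_step (A : Equiv.Perm (Fin 7)) (hA : FERI RR A) (h0 : A 0 = 0) :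
    A.symm 2 = 2 ∨ A.symm 2 = 5 := by
  have c0 : (Tunion RR A 0)ᶜ = ((Finset.univ : Finset (Fin 7)) : Set (Fin 7)) := by
    simp [Tunion]
  have u1 : Tunion RR A 1 = (({0} : Finset (Fin 7)) : Set (Fin 7)) := by
    ext o
    rw [Tunion, c0]
    simp only [top_iff]
    have hn : ∀ j, A j ∉ Tunion RR A 0 := by intro j; simp [Tunion]
    have key : (∃ j, topB j Finset.univ o) ↔ o = 0 := by revert o; decide
    simp only [Set.mem_union, Set.mem_ofPred_eq, hn, not_false_eq_true, true_and, key]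
    simp [Tunion]
  have c1 : (Tunion RR A 1)ᶜ = (({1,2,3,4,5,6} : Finset (Fin 7)) : Set (Fin 7)) := by
    rw [u1, ← Finset.coe_compl]; congr 1
  have m1 : ∀ j, A j ∉ Tunion RR A 1 ↔ j ≠ 0 := by
    intro j
    rw [u1]
    simp only [Finset.coe_singleton, Set.mem_singleton_iff, ne_eq]
    rw [← h0, A.injective.eq_iff, h0]
  have t1 : ∀ o, o ∈ Tset RR A 1 ↔ o = 3 ∨ o = 5 ∨ o = 6 := by
    intro o
    simp only [Tset, Set.mem_ofPred_eq, c1, top_iff, m1]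
    revert o; decide
  have u2 : Tunion RR A 2 = (({0,3,5,6} : Finset (Fin 7)) : Set (Fin 7)) := by
    ext o
    have := t1 o
    change o ∈ Tunion RR A 1 ∪ Tset RR A 1 ↔ _
    rw [Set.mem_union, this, u1]
    simp
  have c2 : (Tunion RR A 2)ᶜ = (({1,2,4} : Finset (Fin 7)) : Set (Fin 7)) := by
    rw [u2, ← Finset.coe_compl]; congr 1
  have f3 := hA 1 3 ((t1 3).2 (by decide))
  have f5 := hA 1 5 ((t1 5).2 (by decide))
  rw [c1, top_iff] at f3 f5
  have g3 : A.symm 3 = 3 := by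
    generalize A.symm 3 = k at f3; revert k; decide
  have g5 : A.symm 5 = 4 := by
    generalize A.symm 5 = k at f5; revert k; decide
  have e3 : A 3 = 3 := by rw [← g3, A.apply_symm_apply, g3]
  have e5 : A 4 = 5 := by rw [← g5, A.apply_symm_apply]
  have key : ∀ j, j ≠ 0 → j ≠ 3 → j ≠ 4 → A j ≠ 6 → A j ∉ Tunion RR A 2 := by
    intro j a b c d
    rw [u2]
    simp only [Finset.coe_insert, Finset.coe_singleton, Set.mem_insert_iff,
      Set.mem_singleton_iff, not_or]
    refine ⟨fun h => a (A.injective (h.trans h0.symm)),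
      fun h => b (A.injective (h.trans e3.symm)),
      fun h => c (A.injective (h.trans e5.symm)), d⟩
  have h2 : (2 : Fin 7) ∈ Tset RR A 2 := by
    by_cases h : A 2 = 6
    · have h5 : A 5 ≠ 6 := by
        intro h'
        exact absurd (A.injective (h.trans h'.symm)) (by decide)
      refine ⟨5, key 5 (by decide) (by decide) (by decide) h5, ?_⟩
      rw [c2, top_iff]; decide
    · refine ⟨2, key 2 (by decide) (by decide) (by decide) h, ?_⟩
      rw [c2, top_iff]; decide
  have f2 := hA 2 2 h2
  rw [c2, top_iff] at f2
  generalize A.symm 2 = k at f2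
  revert k; decide

theorem eaState_succ_fst (P : Fin 7 → Fin 7 → ℝ) (r : ℕ) (L : List (Finset (Fin 7)))
    (h : ∀ o j, j ∈ (eaState RR P r).2 o ↔ cum L o j) (o : Fin 7) :
    o ∈ eaM RR P (r + 1) ↔ ∑ k, (if cum L o k then P k o else 0) < 1 := by
  simp only [eaM, eaState, Set.mem_ofPred_eq]
  have : ∀ k, ((eaState RR P r).2 o).indicator (fun k' => P k' o) k
      = if cum L o k then P k o else 0 := by
    intro k
    by_cases hk : cum L o k
    · rw [if_pos hk, Set.indicator_of_mem ((h o k).2 hk)]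
    · rw [if_neg hk, Set.indicator_of_notMem (fun h' => hk ((h o k).1 h'))]
  simp only [this]

theorem eaState_succ_snd (P : Fin 7 → Fin 7 → ℝ) (r : ℕ) (L : List (Finset (Fin 7)))
    (h : ∀ o j, j ∈ (eaState RR P r).2 o ↔ cum L o j) (S : Finset (Fin 7))
    (hS : eaM RR P (r + 1) = (S : Set (Fin 7))) (o j : Fin 7) :
    j ∈ (eaState RR P (r + 1)).2 o ↔ cum (S :: L) o j := by
  change j ∈ (eaState RR P r).2 o ∪ {j | IsTopIn RR j (eaM RR P (r + 1)) o} ↔ _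
  rw [Set.mem_union, h, hS, Set.mem_ofPred_eq, top_iff]
  simp only [cum, List.mem_cons, exists_eq_or_imp]
  exact or_comm

theorem upper_eq (P : Fin 7 → Fin 7 → ℝ) (j o : Fin 7) :
    upperSum (RR j) (P j) o = ∑ x, if rk j x ≤ rk j o then P j x else 0 := by
  unfold upperSum
  refine Finset.sum_congr rfl fun x _ => ?_
  have : x ∈ ucs (RR j) o ↔ rk j x ≤ rk j o := by
    simp only [ucs, RR, Set.mem_ofPred_eq]
    constructor
    · rintro (h | rfl)
      · exact h.le
      · exact le_rfl
    · intro h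
      rcases h.lt_or_eq with h | h
      · exact Or.inl h
      · exact Or.inr (rk_inj j x o h)
  by_cases hx : rk j x ≤ rk j o
  · rw [if_pos hx, Set.indicator_of_mem (this.2 hx)]
  · rw [if_neg hx, Set.indicator_of_notMem (fun h => hx (this.1 h))]

theorem ea_step (P : Fin 7 → Fin 7 → ℝ) (hP : DoublyStochastic P)
    (hE : EaFERI RR P) (hS : SETE RR P) :
    P 0 0 = 1 / 7 ∧ P 2 2 = 0 ∧ P 5 2 = 0 := by
  obtain ⟨hpos, hrow, hcol⟩ := hP
  have hz : ∀ j, P j 0 = P 0 0 := fun j =>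
    hS j 0 0 (mem_prefix _ _ _ (by revert j; decide))
  have h0 : ∀ j, P j 0 = 1 / 7 := by
    have h := hcol 0
    simp only [hz, Finset.sum_const, Finset.card_univ, Fintype.card_fin] at h
    intro j
    rw [hz j]
    norm_num at h
    linarith
  have s12 : P 1 6 = P 2 6 := hS 1 2 6 (mem_prefix _ _ _ (by decide))
  have s15 : P 1 6 = P 5 6 := hS 1 5 6 (mem_prefix _ _ _ (by decide))
  have s16 : P 1 6 = P 6 6 := hS 1 6 6 (mem_prefix _ _ _ (by decide))
  simp only [Fin.sum_univ_seven] at hrow hcol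
  have sat : ∀ r r' : ℕ, r' < r → ∀ (S : Finset (Fin 7)) (o : Fin 7), o ∈ eaM RR P r →
      eaM RR P r' = (S : Set (Fin 7)) → ∀ j, topB j S o →
      ∑ x, (if rk j x ≤ rk j o then P j x else 0) = 1 := by
    intro r r' hr S o ho hS j hj
    rw [← upper_eq]
    refine hE r o ho j ⟨r', hr, ?_⟩
    simp only [eaE, Set.mem_ofPred_eq, hS]
    exact (top_iff _ _ _).2 hj
  -- round 0
  have M0 : eaM RR P 0 = ((Finset.univ : Finset (Fin 7)) : Set (Fin 7)) := by
    simp [eaM, eaState]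
  have E0 : ∀ o j, j ∈ (eaState RR P 0).2 o ↔ cum [Finset.univ] o j := by
    intro o j
    have := top_iff j Finset.univ o
    rw [Finset.coe_univ] at this
    simp only [eaState, Set.mem_ofPred_eq, cum, List.mem_singleton, exists_eq_left, this]
  -- round 1
  have M1 : eaM RR P 1 = (({1,2,3,4,5,6} : Finset (Fin 7)) : Set (Fin 7)) := by
    ext o
    rw [eaState_succ_fst P 0 _ E0, Finset.mem_coe, Fin.sum_univ_seven]
    fin_cases o
    · simp +decide [h0]
      norm_num
    all_goals simp +decide
  have E1 := eaState_succ_snd P 0 _ E0 _ M1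
  have F1 := eaState_succ_fst P 1 _ E1
  have n6 : (6 : Fin 7) ∉ eaM RR P 2 := by
    intro h
    have q1 := sat 2 1 (by decide) _ 6 h M1 1 (by decide)
    rw [Fin.sum_univ_seven] at q1
    simp +decide at q1
    linarith [hcol 6, h0 1, hpos 0 6, hpos 3 6, hpos 4 6]
  have g6 := n6
  rw [F1, Fin.sum_univ_seven] at g6
  simp +decide at g6
  have r01 : P 0 1 ≤ 6 / 7 := by
    linarith [hrow 0, h0 0, hpos 0 2, hpos 0 3, hpos 0 4, hpos 0 5, hpos 0 6]
  have r33 : P 3 3 ≤ 6 / 7 := by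
    linarith [hrow 3, h0 3, hpos 3 1, hpos 3 2, hpos 3 4, hpos 3 5, hpos 3 6]
  have r45 : P 4 5 ≤ 6 / 7 := by
    linarith [hrow 4, h0 4, hpos 4 1, hpos 4 2, hpos 4 3, hpos 4 4, hpos 4 6]
  have M2 : eaM RR P 2 = (({1,2,3,4,5} : Finset (Fin 7)) : Set (Fin 7)) := by
    ext o
    rw [Finset.mem_coe]
    by_cases h6 : o = 6
    · subst h6
      simp only [n6, false_iff]
      decide
    rw [F1, Fin.sum_univ_seven]
    fin_cases o
    · simp +decide [h0]
      norm_num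
    · simp +decide; linarith
    · simp +decide
    · simp +decide; linarith
    · simp +decide
    · simp +decide; linarith
    · exact absurd rfl h6
  have E2 := eaState_succ_snd P 1 _ E1 _ M2
  have F2 := eaState_succ_fst P 2 _ E2
  have v01 : P 0 1 = 6 / 7 := by
    have q := sat 2 1 (by decide) _ 1 (by rw [M2]; simp) M1 0 (by decide)
    rw [Fin.sum_univ_seven] at q
    simp +decide at q
    linarith [h0 0]
  have v33 : P 3 3 = 6 / 7 := by
    have q := sat 2 1 (by decide) _ 3 (by rw [M2]; simp) M1 3 (by decide)
    rw [Fin.sum_univ_seven] at q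
    simp +decide at q
    linarith [h0 3]
  have w6 : P 1 6 = 1 / 4 := by
    linarith [hcol 6, hpos 0 6, hpos 3 6, hpos 4 6]
  have n1 : (1 : Fin 7) ∉ eaM RR P 3 := by
    intro h
    have q := sat 3 2 (by decide) _ 1 h M2 1 (by decide)
    rw [Fin.sum_univ_seven] at q
    simp +decide at q
    linarith [hcol 1, h0 1, hpos 2 1, hpos 3 1, hpos 4 1, hpos 5 1, hpos 6 1]
  have n3 : (3 : Fin 7) ∉ eaM RR P 3 := by
    intro h
    have q := sat 3 2 (by decide) _ 3 h M2 2 (by decide)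
    rw [Fin.sum_univ_seven] at q
    simp +decide at q
    linarith [hcol 3, h0 2, hpos 0 3, hpos 1 3, hpos 4 3, hpos 5 3, hpos 6 3]
  have g1 := n1
  rw [F2, Fin.sum_univ_seven] at g1
  simp +decide at g1
  have g3 := n3
  rw [F2, Fin.sum_univ_seven] at g3
  simp +decide at g3
  have M3 : eaM RR P 3 = (({2,4,5} : Finset (Fin 7)) : Set (Fin 7)) := by
    ext o
    rw [Finset.mem_coe]
    by_cases h1 : o = 1
    · subst h1
      simp only [n1, false_iff]
      decide
    by_cases h3 : o = 3
    · subst h3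
      simp only [n3, false_iff]
      decide
    rw [F2, Fin.sum_univ_seven]
    fin_cases o
    · simp +decide [h0]
      norm_num
    · exact absurd rfl h1
    · simp +decide
    · exact absurd rfl h3
    · simp +decide
    · simp +decide; linarith
    · simp +decide; linarith
  have E3 := eaState_succ_snd P 2 _ E2 _ M3
  have F3 := eaState_succ_fst P 3 _ E3
  have n2 : (2 : Fin 7) ∉ eaM RR P 4 := by
    intro h
    have q := sat 4 3 (by decide) _ 2 h M3 1 (by decide)
    have q' := sat 4 3 (by decide) _ 2 h M3 6 (by decide)
    rw [Fin.sum_univ_seven] at q q'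
    simp +decide at q q'
    linarith [hcol 1, hcol 2, hcol 3, h0 1, h0 6, hpos 2 1, hpos 3 1, hpos 4 1, hpos 5 1,
      hpos 0 3, hpos 1 3, hpos 4 3, hpos 6 3, hpos 0 2, hpos 2 2, hpos 3 2, hpos 4 2, hpos 5 2]
  rw [F3, Fin.sum_univ_seven] at n2
  simp +decide at n2
  refine ⟨h0 0, ?_, ?_⟩
  · linarith [hcol 2, hpos 0 2, hpos 2 2, hpos 3 2, hpos 4 2, hpos 5 2]
  · linarith [hcol 2, hpos 0 2, hpos 2 2, hpos 3 2, hpos 4 2, hpos 5 2]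

/-- On some instance, no random assignment satisfies ex-post FERI,
ea-FERI and SETE simultaneously. -/
theorem no_epFERI_eaFERI_SETE :
    ∃ (n : ℕ) (R : Pref n), IsProfile R ∧
      ∀ P : Fin n → Fin n → ℝ, DoublyStochastic P →
        ¬ (ExPost (FERI R) P ∧ EaFERI R P ∧ SETE R P) := by
  refine ⟨7, RR, RR_profile, ?_⟩
  rintro P hP ⟨⟨w, hw, -, hX, hPw⟩, hE, hS⟩
  obtain ⟨h00, h22, h52⟩ := ea_step P hP hE hS
  have hne : ∑ A, w A * permMatrix A 0 0 ≠ 0 := by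
    rw [← hPw, h00]; norm_num
  obtain ⟨A, -, hA⟩ := Finset.exists_ne_zero_of_sum_ne_zero hne
  have hwA : w A ≠ 0 := left_ne_zero_of_mul hA
  have hA0 : A 0 = 0 := by
    by_contra h
    exact hA (by simp [permMatrix, h])
  have fin : ∀ k, A.symm 2 = k → P k 2 ≠ 0 := by
    intro k hk h
    rw [hPw] at h
    have hnn : ∀ B ∈ (Finset.univ : Finset (Equiv.Perm (Fin 7))),
        0 ≤ w B * permMatrix B k 2 := by
      intro B _
      refine mul_nonneg (hw B) ?_
      unfold permMatrix
      split_ifs <;> norm_num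
    have := (Finset.sum_eq_zero_iff_of_nonneg hnn).1 h A (Finset.mem_univ _)
    have hAk : A k = 2 := by rw [← hk, A.apply_symm_apply]
    simp [permMatrix, hAk, hwA] at this
  rcases feri_step A (hX A hwA) hA0 with h | h
  · exact fin 2 h h22
  · exact fin 5 h h52

end FeriPaper
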